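/- Let F be a field with prime field k and let ∅ ≠ O ⊆ F \ {0,1} be Aut(F)-invariant. Assume (1) k(O) ⊊ F, and (2) if char(F) = 2 then F is perfect and |F| > 4. Then the group of O-preserving permutations of F ∪ {∞} is exactly PΓL₂(F). -/

import Mathlib

open scoped Classical

/-- The cross-ratio `[a,b;c,d]` on the projective line `F ∪ {∞}` (modelled as
`Option F`, with `none` playing the role of `∞`), with the usual conventions
at `∞`; junk value `0` when two or more of the arguments are `∞`. -/
noncomputable def crossRatio {F : Type*} [Field F] :
    Option F → Option F → Option F → Option F → F
  | none,   some b, some c, some d => (d - b) / (c - b)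
  | some a, none,   some c, some d => (c - a) / (d - a)
  | some a, some b, none,   some d => (d - b) / (d - a)
  | some a, some b, some c, none   => (c - a) / (c - b)
  | some a, some b, some c, some d => ((c - a) / (c - b)) * ((d - b) / (d - a))
  | _, _, _, _ => 0

/-- A permutation `f` of the projective line is `O`-preserving if for all
quadruples of distinct points, `[a,b;c,d] ∈ O ↔ [f a, f b; f c, f d] ∈ O`. -/
def OPreserving {F : Type*} [Field F] (O : Set F) (f : Equiv.Perm (Option F)) : Prop :=
  ∀ a b c d : Option F, a ≠ b → a ≠ c → a ≠ d → b ≠ c → b ≠ d → c ≠ d →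
    (crossRatio a b c d ∈ O ↔ crossRatio (f a) (f b) (f c) (f d) ∈ O)

/-- The map `x ↦ (a σ(x) + b)/(c σ(x) + d)` on the projective line `F ∪ {∞}`,
with the usual conventions at `∞`. -/
noncomputable def moebius {F : Type*} [Field F] (σ : F ≃+* F) (a b c d : F) :
    Option F → Option F
  | none => if c = 0 then none else some (a / c)
  | some x => if c * σ x + d = 0 then none else some ((a * σ x + b) / (c * σ x + d))

/-- `PΓL₂(F)`: the group of permutations of the projective line `F ∪ {∞}` of the
form `x ↦ (a σ(x) + b)/(c σ(x) + d)` with `ad - bc ≠ 0` and `σ ∈ Aut(F)`. -/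
def PGammaL2 (F : Type*) [Field F] : Set (Equiv.Perm (Option F)) :=
  {f | ∃ (σ : F ≃+* F) (a b c d : F), a * d - b * c ≠ 0 ∧
        ∀ x, f x = moebius σ a b c d x}

/-- A `K`-chain: the image of `K ∪ {∞}` under an element of `PΓL₂(F)`. -/
def IsKChain {F : Type*} [Field F] (K : Subfield F) (X : Set (Option F)) : Prop :=
  ∃ g ∈ PGammaL2 F, X = ⇑g '' (some '' (K : Set F) ∪ {none})

section Affine
variable {F : Type*} [Field F] {K : Subfield F} {g : Equiv.Perm F}

/-- A permutation `g` of `F` preserves `K`-collinearity of triples of points. -/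
def PreservesCollinear (K : Subfield F) (g : Equiv.Perm F) : Prop :=
  ∀ x y z, x ≠ y → ((z - x) / (y - x) ∈ K ↔ (g z - g x) / (g y - g x) ∈ K)

namespace PreservesCollinear

theorem div_mem_iff (hg : PreservesCollinear K g) (h0 : g 0 = 0) {x : F} (hx : x ≠ 0) (z : F) :
    z / x ∈ K ↔ g z / g x ∈ K := by
  simpa [h0] using hg 0 x z hx.symm

theorem map_ne_zero (h0 : g 0 = 0) {x : F} (hx : x ≠ 0) : g x ≠ 0 := by
  rw [← h0]; exact fun h => hx (g.injective h)

theorem exists_eq_mul (hg : PreservesCollinear K g) (h0 : g 0 = 0) {l : F} (hl : l ∈ K)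
    {x : F} (hx : x ≠ 0) : ∃ a ∈ K, g (l * x) = a * g x := by
  have h := (hg.div_mem_iff h0 hx (l * x)).1 (by rwa [mul_div_cancel_right₀ _ hx])
  exact ⟨_, h, (div_mul_cancel₀ _ (map_ne_zero h0 hx)).symm⟩

theorem eq_one_of_map_add_eq (hg : PreservesCollinear K g) (h0 : g 0 = 0) {x y : F} (hx : x ≠ 0)
    (hxy : y / x ∉ K) {a b : F} (ha : a ∈ K) (hb : b ∈ K)
    (h : g (x + y) = a * g x + b * g y) : b = 1 := by
  by_contra hb1
  have hb1' : (1 - b) ≠ 0 := fun h => hb1 (sub_eq_zero.1 h).symm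
  have hgx := map_ne_zero h0 hx
  have hne : y ≠ x + y := by simpa [eq_comm] using hx
  have hgne : g (x + y) - g y ≠ 0 := sub_ne_zero.2 fun h => hne (g.injective h).symm
  have hcol := hg y (x + y) (g.symm (a / (1 - b) * g x)) hne
  have hray := hg.div_mem_iff h0 hx (g.symm (a / (1 - b) * g x))
  rw [g.apply_symm_apply] at hcol hray
  have hab : a / (1 - b) ∈ K := K.div_mem ha (K.sub_mem K.one_mem hb)
  have h1 := hray.2 (by rwa [mul_div_cancel_right₀ _ hgx])
  have h2 := hcol.2 (by
    have : (a / (1 - b) * g x - g y) / (g (x + y) - g y) = 1 / (1 - b) := by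
      rw [div_eq_div_iff hgne hb1', h]
      field_simp
      ring
    rw [this]
    exact K.div_mem K.one_mem (K.sub_mem K.one_mem hb))
  rw [add_sub_cancel_right, sub_div] at h2
  exact hxy (by simpa using K.sub_mem h1 h2)

theorem map_add_of_div_notMem (hg : PreservesCollinear K g) (h0 : g 0 = 0)
    {s : F} (hs : s ∈ K) (hs0 : s ≠ 0) (hs1 : s ≠ 1) {x y : F} (hx : x ≠ 0)
    (hxy : y / x ∉ K) : g (x + y) = g x + g y := by
  have hs1' : 1 - s ≠ 0 := fun h => hs1 (sub_eq_zero.1 h).symm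
  have hy : y ≠ 0 := by rintro rfl; simp [K.zero_mem] at hxy
  have hyx : x / y ∉ K := fun h => hxy (by simpa using K.inv_mem h)
  have hsK := K.sub_mem K.one_mem hs
  obtain ⟨a, ha, hax⟩ := hg.exists_eq_mul h0 (K.inv_mem hs) hx
  obtain ⟨b, hb, hby⟩ := hg.exists_eq_mul h0 (K.inv_mem hsK) hy
  have hne : s⁻¹ * x ≠ (1 - s)⁻¹ * y := fun h => hxy (by
    have : y / x = (1 - s) * s⁻¹ := by
      field_simp at h ⊢
      linear_combination -h
    rw [this]
    exact K.mul_mem hsK (K.inv_mem hs))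
  have hgne : g ((1 - s)⁻¹ * y) - g (s⁻¹ * x) ≠ 0 :=
    sub_ne_zero.2 fun h => hne (g.injective h).symm
  have ht := (hg _ _ (x + y) hne).1 (by
    have : (x + y - s⁻¹ * x) / ((1 - s)⁻¹ * y - s⁻¹ * x) = 1 - s := by
      rw [div_eq_iff (sub_ne_zero.2 hne.symm)]
      field_simp
      ring
    rwa [this])
  obtain ⟨t, htdef⟩ : ∃ t, t = (g (x + y) - g (s⁻¹ * x)) / (g ((1 - s)⁻¹ * y) - g (s⁻¹ * x)) :=
    ⟨_, rfl⟩
  rw [← htdef] at ht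
  rw [eq_div_iff hgne, hax, hby] at htdef
  have h : g (x + y) = (a - t * a) * g x + t * b * g y := by linear_combination -htdef
  have hα : a - t * a ∈ K := K.sub_mem ha (K.mul_mem ht ha)
  have hβ : t * b ∈ K := K.mul_mem ht hb
  have h1 := hg.eq_one_of_map_add_eq h0 hx hxy hα hβ h
  have h2 := hg.eq_one_of_map_add_eq h0 hy hyx hβ hα (by rw [add_comm, h, add_comm])
  rw [h, h1, h2, one_mul, one_mul]

theorem map_add (hg : PreservesCollinear K g) (h0 : g 0 = 0) (hK : K ≠ ⊤)
    {s : F} (hs : s ∈ K) (hs0 : s ≠ 0) (hs1 : s ≠ 1) (x y : F) : g (x + y) = g x + g y := by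
  by_cases hx : x = 0
  · simp [hx, h0]
  by_cases hxy : y / x ∈ K
  swap
  · exact hg.map_add_of_div_notMem h0 hs hs0 hs1 hx hxy
  by_cases hy : y = 0
  · simp [hy, h0]
  obtain ⟨w, hw⟩ : ∃ w, w ∉ K := by
    by_contra! h
    exact hK (eq_top_iff.2 fun z _ => h z)
  have key : ∀ {u v : F}, u ≠ 0 → v / u ∉ K → g (u + v) = g u + g v :=
    hg.map_add_of_div_notMem h0 hs hs0 hs1
  have e1 : g (x + (y + w * x)) = g x + (g y + g (w * x)) := by
    rw [key hx, key hy]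
    · intro h
      have := K.mul_mem h hxy
      rw [show w * x / y * (y / x) = w by field_simp] at this
      exact hw this
    · intro h
      have := K.sub_mem h hxy
      rw [show (y + w * x) / x - y / x = w by field_simp; ring] at this
      exact hw this
  have e2 : g (x + y + w * x) = g (x + y) + g (w * x) := by
    by_cases hs : x + y = 0
    · simp [hs, h0]
    refine key hs fun h => hw ?_
    have := K.mul_mem h (K.add_mem K.one_mem hxy)
    rwa [show w * x / (x + y) * (1 + y / x) = w by field_simp] at this
  rw [← add_assoc, e2] at e1
  linear_combination e1

theorem map_mul (hg : PreservesCollinear K g) (h0 : g 0 = 0) (h1 : g 1 = 1) (hK : K ≠ ⊤)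
    {s : F} (hs : s ∈ K) (hs0 : s ≠ 0) (hs1 : s ≠ 1) {l : F} (hl : l ∈ K) (x : F) :
    g (l * x) = g l * g x := by
  have key : ∀ l ∈ K, ∀ x ∉ K, g (l * x) = g l * g x := by
    intro l hl x hx
    have hx0 : x ≠ 0 := by rintro rfl; exact hx K.zero_mem
    have hx1 : x + 1 ≠ 0 := fun h => hx (by
      rw [eq_neg_of_add_eq_zero_left h]; exact K.neg_mem K.one_mem)
    obtain ⟨a, ha, hax⟩ := hg.exists_eq_mul h0 hl hx0
    obtain ⟨b, hb, hbx⟩ := hg.exists_eq_mul h0 hl hx1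
    obtain ⟨c, hc, hcx⟩ := hg.exists_eq_mul h0 hl one_ne_zero
    rw [h1, mul_one, mul_one] at hcx
    rw [mul_add, hg.map_add h0 hK hs hs0 hs1, hg.map_add h0 hK hs hs0 hs1, hax, h1, mul_one,
      hcx] at hbx
    have hgx : g x ∉ K := fun h => hx <| by
      simpa using (hg.div_mem_iff h0 one_ne_zero x).2 (by simpa [h1] using h)
    have hab : a = b := by
      by_contra hab
      have hab' : a - b ≠ 0 := sub_ne_zero.2 hab
      apply hgx
      rw [show g x = (b - c) / (a - b) by field_simp; linear_combination hbx]
      exact K.div_mem (K.sub_mem hb hc) (K.sub_mem ha hb)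
    subst hab
    rw [hax, hcx]
    linear_combination (-g x) * hbx
  by_cases hx : x ∈ K
  swap
  · exact key l hl x hx
  obtain ⟨w, hw⟩ : ∃ w, w ∉ K := by
    by_contra! h
    exact hK (eq_top_iff.2 fun z _ => h z)
  by_cases hx0 : x = 0
  · simp [hx0, h0]
  have hxw : x * w ∉ K := fun h => hw (by simpa [hx0] using K.mul_mem (K.inv_mem hx) h)
  have hgw : g w ≠ 0 := map_ne_zero h0 (by rintro rfl; exact hw K.zero_mem)
  have e := key (l * x) (K.mul_mem hl hx) w hw
  rw [mul_assoc, key l hl _ hxw, key x hx w hw] at e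
  exact mul_right_cancel₀ hgw (by rw [← e, mul_assoc])

end PreservesCollinear

/-- An additive map `h` for which `x ↦ (h x⁻¹)⁻¹` is also additive preserves squares. -/
theorem map_sq_of_map_inv {f h : F → F} (hf : ∀ x y, f (x + y) = f x + f y)
    (hh : ∀ x y, h (x + y) = h x + h y) (h0 : ∀ x, h x = 0 ↔ x = 0) (h1 : h 1 = 1)
    (hfh : ∀ x, f x⁻¹ = (h x)⁻¹) (x : F) : h (x ^ 2) = h x ^ 2 := by
  by_cases hx : x = 0
  · simp [hx, (h0 0).2]
  by_cases hx1 : x + 1 = 0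
  · have hn : h x = -1 := by
      have := hh x 1
      rw [hx1, (h0 0).2 rfl, h1] at this
      linear_combination -this
    have : x = -1 := by linear_combination hx1
    rw [hn, this]; simp [h1]
  have H0 : h x ≠ 0 := fun h => hx ((h0 x).1 h)
  have H1 : h x + 1 ≠ 0 := by
    rw [← h1, ← hh]; exact fun h => hx1 ((h0 _).1 h)
  have H2 : h (x ^ 2 + x) ≠ 0 := by
    rw [Ne, h0, show x ^ 2 + x = x * (x + 1) by ring]; exact mul_ne_zero hx hx1
  have e := hf (x + 1)⁻¹ (x ^ 2 + x)⁻¹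
  have : (x + 1)⁻¹ + (x ^ 2 + x)⁻¹ = x⁻¹ := by
    rw [show x ^ 2 + x = x * (x + 1) by ring]
    field_simp
  rw [this, hfh, hfh, hfh, hh x 1, h1, hh] at e
  rw [hh] at H2
  generalize h (x ^ 2) = q at *
  field_simp at e
  linear_combination e

theorem map_cube_of_map_inv [CharP F 2] {f h : F → F} (hf : ∀ x y, f (x + y) = f x + f y)
    (hh : ∀ x y, h (x + y) = h x + h y) (h0 : ∀ x, h x = 0 ↔ x = 0) (h1 : h 1 = 1)
    (hfh : ∀ x, f x⁻¹ = (h x)⁻¹)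
    (hfK : ∀ l ∈ K, ∀ x, f (l * x) = f l * f x) (hhK : ∀ l ∈ K, ∀ x, h (l * x) = h l * h x)
    {s : F} (hs : s ∈ K) (hs0 : s ≠ 0) (hs1 : s ≠ 1) (x : F) : h (x ^ 3) = h x ^ 3 := by
  have two : (2 : F) = 0 := CharTwo.two_eq_zero
  have ne_zero : ∀ {a b : F}, a ≠ b → a + b ≠ 0 := fun h => by rwa [Ne, CharTwo.add_eq_zero]
  have hsq := map_sq_of_map_inv hf hh h0 h1 hfh
  by_cases hxK : x ∈ K
  · rw [pow_succ', hhK x hxK, hsq]; ring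
  have hx : x ≠ 0 := by rintro rfl; exact hxK K.zero_mem
  have hx1 : x + 1 ≠ 0 := ne_zero (by rintro rfl; exact hxK K.one_mem)
  have hxs : x + s ≠ 0 := ne_zero (by rintro rfl; exact hxK hs)
  have hs1' : 1 + s ≠ 0 := ne_zero hs1.symm
  have nz : ∀ {a}, a ≠ 0 → h a ≠ 0 := fun ha h => ha ((h0 _).1 h)
  have H := nz hx
  have H1 := nz hx1
  have Hs := nz hxs
  have S := nz hs0
  have S1 := nz hs1'
  have hsK := K.inv_mem hs
  have hs1K := K.inv_mem (K.add_mem K.one_mem hs)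
  have hmul : x * (x + 1) * (x + s) ≠ 0 := mul_ne_zero (mul_ne_zero hx hx1) hxs
  have M := nz hmul
  have e : s⁻¹ * x⁻¹ + (1 + s)⁻¹ * (x + 1)⁻¹ + s⁻¹ * ((1 + s)⁻¹ * (x + s)⁻¹)
      = (x * (x + 1) * (x + s))⁻¹ := by
    field_simp
    linear_combination (x ^ 2 + x + x ^ 2 * s + x * s + x * s ^ 2) * two
  have e' := congrArg f e
  rw [hf, hf, hfK _ hsK, hfK _ hs1K, hfK _ hsK, hfK _ hs1K] at e'
  simp only [hfh] at e'
  have ex : h (x * (x + 1) * (x + s)) = h (x ^ 3) + h x ^ 2 + h s * h x ^ 2 + h s * h x := by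
    rw [show x * (x + 1) * (x + s) = x ^ 3 + x ^ 2 + s * x ^ 2 + s * x by ring,
      hh, hh, hh, hhK s hs, hhK s hs, hsq]
  have ey : h (x * (x + 1) * (x + s)) = h x * h (x + 1) * h (x + s) := by
    rw [← inv_inj, ← e']
    rw [hh, h1] at H1 S1
    rw [hh] at Hs
    rw [hh, hh, hh, h1]
    field_simp
    linear_combination (h x ^ 2 + h x + h x ^ 2 * h s + h x * h s + h x * h s ^ 2) * two
  rw [ex, hh, hh, h1] at ey
  linear_combination ey

theorem map_mul_of_map_sq (h2 : (2 : F) ≠ 0) {h : F → F} (hh : ∀ x y, h (x + y) = h x + h y)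
    (hsq : ∀ x, h (x ^ 2) = h x ^ 2) (x y : F) : h (x * y) = h x * h y := by
  have e := hsq (x + y)
  rw [show (x + y) ^ 2 = x ^ 2 + (x * y + x * y) + y ^ 2 by ring] at e
  simp only [hh, hsq] at e
  exact mul_left_cancel₀ h2 (by linear_combination e)

theorem map_mul_of_map_cube [CharP F 2] (hperf : ∀ y : F, ∃ z, z ^ 2 = y) {h : F → F}
    (hh : ∀ x y, h (x + y) = h x + h y) (h0 : ∀ x, h x = 0 ↔ x = 0) (h1 : h 1 = 1)
    (hsq : ∀ x, h (x ^ 2) = h x ^ 2) (hcube : ∀ x, h (x ^ 3) = h x ^ 3)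
    (hhK : ∀ l ∈ K, ∀ x, h (l * x) = h l * h x)
    {s : F} (hs : s ∈ K) (hs0 : s ≠ 0) (hs1 : s ≠ 1) (x y : F) : h (x * y) = h x * h y := by
  have two : (2 : F) = 0 := CharTwo.two_eq_zero
  have polar : ∀ x y, h (x ^ 2 * y) + h (x * y ^ 2) = h x ^ 2 * h y + h x * h y ^ 2 := by
    intro x y
    have e := hcube (x + y)
    rw [show (x + y) ^ 3 = x ^ 3 + x ^ 2 * y + x * y ^ 2 + y ^ 3 by
      linear_combination (x ^ 2 * y + x * y ^ 2) * two] at e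
    simp only [hh, hcube] at e
    linear_combination e + (h x ^ 2 * h y + h x * h y ^ 2) * two
  obtain ⟨z, rfl⟩ := hperf x
  have e1 := polar z y
  have e2 := polar z (s * y)
  rw [show z ^ 2 * (s * y) = s * (z ^ 2 * y) by ring,
    show z * (s * y) ^ 2 = s * (s * (z * y ^ 2)) by ring, hhK s hs, hhK s hs, hhK s hs,
    hhK s hs] at e2
  have S0 : h s ≠ 0 := fun h => hs0 ((h0 s).1 h)
  have S1 : h s + 1 ≠ 0 := by
    rw [← h1, ← hh, Ne, h0, CharTwo.add_eq_zero]; exact hs1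
  rw [hsq]
  refine mul_left_cancel₀ (mul_ne_zero S0 S1) ?_
  linear_combination (h s)^2 * e1 - e2 + (h s * h (z ^ 2 * y) - h s * (h z) ^ 2 * h y) * two

end Affine

section Projective
variable {F : Type*} [Field F]

/-- Homogeneous coordinates of a point of the projective line. -/
def homCoord : Option F → F × F
  | none => (1, 0)
  | some x => (x, 1)

/-- The determinant of the homogeneous coordinates of two points. -/
def projDet (p q : Option F) : F :=
  (homCoord p).1 * (homCoord q).2 - (homCoord p).2 * (homCoord q).1

theorem projDet_ne_zero {p q : Option F} (h : p ≠ q) : projDet p q ≠ 0 := by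
  rcases p with _ | x <;> rcases q with _ | y <;> simp_all [projDet, homCoord, sub_eq_zero]

theorem crossRatio_eq_projDet {a b c d : Option F} (hab : a ≠ b) (hac : a ≠ c) (had : a ≠ d)
    (hbc : b ≠ c) (hbd : b ≠ d) (hcd : c ≠ d) :
    crossRatio a b c d = projDet c a * projDet d b / (projDet c b * projDet d a) := by
  rcases a with _ | a <;> rcases b with _ | b <;> rcases c with _ | c <;> rcases d with _ | d <;>
    simp_all [crossRatio, projDet, homCoord, div_mul_div_comm]
  all_goals rw [← neg_div_neg_eq, neg_sub, neg_sub]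

theorem exists_homCoord_moebius (σ : F ≃+* F) {a b c d : F} (h : a * d - b * c ≠ 0)
    (p : Option F) : ∃ r : F, r ≠ 0 ∧
      r * (homCoord (moebius σ a b c d p)).1
        = a * σ (homCoord p).1 + b * σ (homCoord p).2 ∧
      r * (homCoord (moebius σ a b c d p)).2
        = c * σ (homCoord p).1 + d * σ (homCoord p).2 := by
  rcases p with _ | x
  · by_cases hc : c = 0
    · refine ⟨a, ?_, ?_⟩
      · rintro rfl; simp [hc] at h
      · simp [moebius, homCoord, hc]
    · exact ⟨c, hc, by simp [moebius, homCoord, hc, mul_div_cancel₀]⟩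
  · by_cases hc : c * σ x + d = 0
    · refine ⟨a * σ x + b, fun h' => ?_, ?_⟩
      · by_cases hc0 : c = 0
        · simp [hc0] at hc; simp [hc0, hc] at h
        · apply h
          have : c * (a * d - b * c) = 0 := by linear_combination a * c * hc - c * c * h'
          exact (mul_eq_zero.1 this).resolve_left hc0
      · simp [moebius, homCoord, hc]
    · exact ⟨_, hc, by simp [moebius, homCoord, hc, mul_div_cancel₀]⟩

theorem exists_projDet_moebius (σ : F ≃+* F) {a b c d : F} (h : a * d - b * c ≠ 0) :
    ∃ r : Option F → F, (∀ p, r p ≠ 0) ∧ ∀ p q,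
      r p * r q * projDet (moebius σ a b c d p) (moebius σ a b c d q)
        = (a * d - b * c) * σ (projDet p q) := by
  choose r hr h1 h2 using exists_homCoord_moebius σ h
  refine ⟨r, hr, fun p q => ?_⟩
  have e1 := h1 p
  have e2 := h2 p
  have e3 := h1 q
  have e4 := h2 q
  simp only [projDet, map_sub, map_mul]
  set P := homCoord (moebius σ a b c d p)
  set Q := homCoord (moebius σ a b c d q)
  calc _ = (r p * P.1) * (r q * Q.2) - (r p * P.2) * (r q * Q.1) := by ring
    _ = _ := by rw [e1, e2, e3, e4]; ring

theorem moebius_injective (σ : F ≃+* F) {a b c d : F} (h : a * d - b * c ≠ 0) :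
    Function.Injective (moebius σ a b c d) := by
  obtain ⟨r, hr, hdet⟩ := exists_projDet_moebius σ h
  intro p q hpq
  by_contra hne
  have e := hdet p q
  rw [hpq, projDet, mul_comm (homCoord _).1, sub_self, mul_zero] at e
  exact mul_ne_zero h ((map_ne_zero σ).2 (projDet_ne_zero hne)) e.symm

theorem crossRatio_moebius (σ : F ≃+* F) {a b c d : F} (h : a * d - b * c ≠ 0)
    {p q s t : Option F} (hpq : p ≠ q) (hps : p ≠ s) (hpt : p ≠ t) (hqs : q ≠ s) (hqt : q ≠ t)
    (hst : s ≠ t) :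
    crossRatio (moebius σ a b c d p) (moebius σ a b c d q) (moebius σ a b c d s)
      (moebius σ a b c d t) = σ (crossRatio p q s t) := by
  obtain ⟨r, hr, hdet⟩ := exists_projDet_moebius σ h
  have hi := moebius_injective σ h
  have hr' : ∀ p q, projDet (moebius σ a b c d p) (moebius σ a b c d q)
      = (a * d - b * c) * σ (projDet p q) / (r p * r q) := fun p q => by
    rw [eq_div_iff (mul_ne_zero (hr p) (hr q)), ← hdet]; ring
  rw [crossRatio_eq_projDet (hi.ne hpq) (hi.ne hps) (hi.ne hpt) (hi.ne hqs) (hi.ne hqt)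
    (hi.ne hst), crossRatio_eq_projDet hpq hps hpt hqs hqt hst]
  simp only [hr', map_div₀, map_mul]
  have n1 := (map_ne_zero σ).2 (projDet_ne_zero hqs.symm)
  have n2 := (map_ne_zero σ).2 (projDet_ne_zero hpt.symm)
  have := hr p
  have := hr q
  have := hr s
  have := hr t
  field_simp

/-- Elements of `PΓL₂(F)` preserve every `Aut(F)`-invariant set of cross-ratios. -/
theorem opreserving_of_mem_PGammaL2 {O : Set F} (hInv : ∀ σ : F ≃+* F, ∀ x ∈ O, σ x ∈ O)
    {f : Equiv.Perm (Option F)} (hf : f ∈ PGammaL2 F) : OPreserving O f := by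
  obtain ⟨σ, a, b, c, d, h, hf⟩ := hf
  intro p q s t hpq hps hpt hqs hqt hst
  rw [hf, hf, hf, hf, crossRatio_moebius σ h hpq hps hpt hqs hqt hst]
  exact ⟨hInv σ _, fun hx => by simpa using hInv σ.symm _ hx⟩

theorem moebius_refl_surjective {a b c d : F} (h : a * d - b * c ≠ 0) :
    Function.Surjective (moebius (RingEquiv.refl F) a b c d) := by
  rintro (_ | y)
  · by_cases hc : c = 0
    · exact ⟨none, by simp [moebius, hc]⟩
    · refine ⟨some (-d / c), ?_⟩
      simp [moebius, mul_div_cancel₀, hc]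
  · by_cases hy : a - c * y = 0
    · have hc : c ≠ 0 := by
        rintro rfl
        simp at hy; simp [hy] at h
      refine ⟨none, ?_⟩
      simp only [moebius, hc, if_false, Option.some_inj]
      rw [div_eq_iff hc]
      linear_combination hy
    · refine ⟨some ((d * y - b) / (a - c * y)), ?_⟩
      have e : c * ((d * y - b) / (a - c * y)) + d = (a * d - b * c) / (a - c * y) := by
        field_simp; ring
      have hne : (a * d - b * c) / (a - c * y) ≠ 0 := div_ne_zero h hy
      simp only [moebius, RingEquiv.refl_apply, e, hne, if_false, Option.some_inj]
      rw [div_eq_iff hne, ← e]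
      linear_combination div_mul_cancel₀ (d * y - b) hy

/-- The permutation of the projective line given by an invertible matrix. -/
noncomputable def moebiusPerm (a b c d : F) (h : a * d - b * c ≠ 0) : Equiv.Perm (Option F) :=
  Equiv.ofBijective _ ⟨moebius_injective (RingEquiv.refl F) h, moebius_refl_surjective h⟩

/-- A permutation of the projective line given by an invertible matrix. -/
def IsPGL (m : Equiv.Perm (Option F)) : Prop :=
  ∃ a b c d : F, a * d - b * c ≠ 0 ∧ ∀ x, m x = moebius (RingEquiv.refl F) a b c d x

theorem isPGL_moebiusPerm (a b c d : F) (h : a * d - b * c ≠ 0) :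
    IsPGL (moebiusPerm a b c d h) :=
  ⟨a, b, c, d, h, fun _ => rfl⟩

theorem IsPGL.crossRatio {m : Equiv.Perm (Option F)} (hm : IsPGL m)
    {p q s t : Option F} (hpq : p ≠ q) (hps : p ≠ s) (hpt : p ≠ t) (hqs : q ≠ s) (hqt : q ≠ t)
    (hst : s ≠ t) : crossRatio (m p) (m q) (m s) (m t) = crossRatio p q s t := by
  obtain ⟨a, b, c, d, h, hm⟩ := hm
  rw [hm, hm, hm, hm, crossRatio_moebius _ h hpq hps hpt hqs hqt hst, RingEquiv.refl_apply]

theorem IsPGL.opreserving (O : Set F) {m : Equiv.Perm (Option F)} (hm : IsPGL m) :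
    OPreserving O m :=
  fun _ _ _ _ h1 h2 h3 h4 h5 h6 => by rw [hm.crossRatio h1 h2 h3 h4 h5 h6]

theorem OPreserving.mul {O : Set F} {f g : Equiv.Perm (Option F)} (hf : OPreserving O f)
    (hg : OPreserving O g) : OPreserving O (f * g) :=
  fun _ _ _ _ h1 h2 h3 h4 h5 h6 => (hg _ _ _ _ h1 h2 h3 h4 h5 h6).trans <|
    hf _ _ _ _ (g.injective.ne h1) (g.injective.ne h2) (g.injective.ne h3) (g.injective.ne h4)
      (g.injective.ne h5) (g.injective.ne h6)

theorem OPreserving.inv {O : Set F} {f : Equiv.Perm (Option F)} (hf : OPreserving O f) :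
    OPreserving O f⁻¹ := fun a b c d h1 h2 h3 h4 h5 h6 => by
  have hi := (f⁻¹).injective
  have := hf (f⁻¹ a) (f⁻¹ b) (f⁻¹ c) (f⁻¹ d) (hi.ne h1) (hi.ne h2) (hi.ne h3) (hi.ne h4)
    (hi.ne h5) (hi.ne h6)
  simpa using this.symm

theorem exists_isPGL {p q r : Option F} (hpq : p ≠ q) (hpr : p ≠ r) (hqr : q ≠ r) :
    ∃ m : Equiv.Perm (Option F), IsPGL m ∧ m none = p ∧ m (some 0) = q ∧ m (some 1) = r := by
  let u := projDet r q
  let v := projDet p r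
  have hu : u ≠ 0 := projDet_ne_zero hqr.symm
  have hv : v ≠ 0 := projDet_ne_zero hpr
  have hw : projDet p q ≠ 0 := projDet_ne_zero hpq
  let a := u * (homCoord p).1
  let c := u * (homCoord p).2
  let b := v * (homCoord q).1
  let d := v * (homCoord q).2
  have h : a * d - b * c ≠ 0 := by
    have : a * d - b * c = u * v * projDet p q := by simp only [a, b, c, d, projDet]; ring
    rw [this]
    exact mul_ne_zero (mul_ne_zero hu hv) hw
  refine ⟨moebiusPerm a b c d h, isPGL_moebiusPerm a b c d h, ?_, ?_, ?_⟩
  · change moebius (RingEquiv.refl F) a b c d none = p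
    rcases p with _ | p <;> simp [moebius, a, c, homCoord, hu]
  · change moebius (RingEquiv.refl F) a b c d (some 0) = q
    rcases q with _ | q <;> simp [moebius, b, d, homCoord, hv]
  · change moebius (RingEquiv.refl F) a b c d (some 1) = r
    have e1 : a + b = projDet p q * (homCoord r).1 := by
      simp only [a, b, u, v, projDet]; ring
    have e2 : c + d = projDet p q * (homCoord r).2 := by
      simp only [c, d, u, v, projDet]; ring
    simp only [moebius, map_one, mul_one, e1, e2]
    rcases r with _ | r <;> simp [homCoord, hw]

/-- A set of points is `O`-closed if it contains with `a, b, c` also all `d` such that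
`[a,b;c,d] ∈ O`. -/
def OClosed (O : Set F) (X : Set (Option F)) : Prop :=
  ∀ a b c d : Option F, a ≠ b → a ≠ c → a ≠ d → b ≠ c → b ≠ d → c ≠ d →
    a ∈ X → b ∈ X → c ∈ X → crossRatio a b c d ∈ O → d ∈ X

/-- The smallest `O`-closed set containing three given points. -/
def OClosure (O : Set F) (p q r : Option F) : Set (Option F) :=
  {d | ∀ X, OClosed O X → p ∈ X → q ∈ X → r ∈ X → d ∈ X}

theorem oclosed_oclosure (O : Set F) (p q r : Option F) : OClosed O (OClosure O p q r) :=
  fun _ _ _ _ h1 h2 h3 h4 h5 h6 ha hb hc hO X hX hp hq hr =>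
    hX _ _ _ _ h1 h2 h3 h4 h5 h6 (ha X hX hp hq hr) (hb X hX hp hq hr) (hc X hX hp hq hr) hO

theorem OPreserving.oclosed_preimage {O : Set F} {f : Equiv.Perm (Option F)}
    (hf : OPreserving O f) {X : Set (Option F)} (hX : OClosed O X) : OClosed O (f ⁻¹' X) :=
  fun _ _ _ _ h1 h2 h3 h4 h5 h6 ha hb hc hO =>
    hX _ _ _ _ (f.injective.ne h1) (f.injective.ne h2) (f.injective.ne h3)
      (f.injective.ne h4) (f.injective.ne h5) (f.injective.ne h6) ha hb hc
      ((hf _ _ _ _ h1 h2 h3 h4 h5 h6).1 hO)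

theorem OPreserving.mem_oclosure {O : Set F} {f : Equiv.Perm (Option F)}
    (hf : OPreserving O f) {p q r d : Option F} (hd : d ∈ OClosure O p q r) :
    f d ∈ OClosure O (f p) (f q) (f r) :=
  fun _ hX hp hq hr => hd _ (hf.oclosed_preimage hX) hp hq hr

theorem OPreserving.mem_oclosure_iff {O : Set F} {f : Equiv.Perm (Option F)}
    (hf : OPreserving O f) {p q r d : Option F} :
    f d ∈ OClosure O (f p) (f q) (f r) ↔ d ∈ OClosure O p q r :=
  ⟨fun h => by simpa using hf.inv.mem_oclosure h, hf.mem_oclosure⟩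

theorem oclosed_subfield {O : Set F} {K : Subfield F} (hOK : O ⊆ K) :
    OClosed O {x | ∀ y, x = some y → y ∈ K} := by
  intro a b c d h1 h2 h3 h4 h5 h6 ha hb hc hO
  have hK := hOK hO
  obtain ⟨l, hl⟩ : ∃ l, l = crossRatio a b c d := ⟨_, rfl⟩
  rw [← hl] at hK
  have hne := projDet_ne_zero h1
  rw [crossRatio_eq_projDet h1 h2 h3 h4 h5 h6, eq_div_iff (mul_ne_zero
    (projDet_ne_zero h4.symm) (projDet_ne_zero h3.symm))] at hl
  rintro y rfl
  have memK : ∀ p : Option F, (∀ y, p = some y → y ∈ K) →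
      (homCoord p).1 ∈ K ∧ (homCoord p).2 ∈ K := by
    rintro (_ | p) hp
    · exact ⟨K.one_mem, K.zero_mem⟩
    · exact ⟨hp p rfl, K.one_mem⟩
  obtain ⟨a1, a2⟩ := memK a ha
  obtain ⟨b1, b2⟩ := memK b hb
  obtain ⟨c1, c2⟩ := memK c hc
  have hca : projDet c a ∈ K := K.sub_mem (K.mul_mem c1 a2) (K.mul_mem c2 a1)
  have hcb : projDet c b ∈ K := K.sub_mem (K.mul_mem c1 b2) (K.mul_mem c2 b1)
  set A := projDet c a
  set B := projDet c b
  have hA : A ≠ 0 := projDet_ne_zero h2.symm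
  have hy : ∀ p, projDet (some y) p = y * (homCoord p).2 - (homCoord p).1 := fun p => by
    rw [projDet]
    simp only [homCoord, one_mul]
  rw [hy, hy] at hl
  have e : y * (l * B * (homCoord a).2 - A * (homCoord b).2)
      = l * B * (homCoord a).1 - A * (homCoord b).1 := by linear_combination hl
  have hz : l * B * (homCoord a).2 - A * (homCoord b).2 ≠ 0 := by
    intro hz
    rw [hz, mul_zero] at e
    have : A * projDet a b = 0 := by
      simp only [projDet]
      linear_combination -(homCoord a).2 * e - (homCoord a).1 * hz
    exact mul_ne_zero hA hne this
  rw [eq_div_of_mul_eq hz e]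
  have hlB := K.mul_mem hK hcb
  exact K.div_mem (K.sub_mem (K.mul_mem hlB a1) (K.mul_mem hca b1))
    (K.sub_mem (K.mul_mem hlB a2) (K.mul_mem hca b2))

theorem IsPGL.mem_oclosure {O : Set F} {m : Equiv.Perm (Option F)} (hm : IsPGL m)
    {X : Set (Option F)} (hX : OClosed O X) {d : Option F}
    (hd : d ∈ OClosure O none (some 0) (some 1))
    (h1 : m none ∈ X) (h2 : m (some 0) ∈ X) (h3 : m (some 1) ∈ X) : m d ∈ X :=
  (hm.opreserving O).mem_oclosure hd X hX h1 h2 h3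

theorem some_mem_oclosure_iff {O : Set F} (hne : O.Nonempty) (hO : ∀ x ∈ O, x ≠ 0 ∧ x ≠ 1)
    {x : F} : some x ∈ OClosure O none (some 0) (some 1) ↔ x ∈ Subfield.closure O := by
  set C := OClosure O none (some 0) (some 1) with hC
  have hcl : OClosed O C := oclosed_oclosure _ _ _ _
  have hinf : none ∈ C := fun _ _ h _ _ => h
  have hzero : some 0 ∈ C := fun _ _ _ h _ => h
  have hone : some 1 ∈ C := fun _ _ _ _ h => h
  refine ⟨fun h => ?_, fun h => ?_⟩
  · refine h _ (oclosed_subfield Subfield.subset_closure) ?_ ?_ ?_ x rfl <;> simp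
  have hOC : ∀ o ∈ O, some o ∈ C := by
    intro o ho
    refine hcl none (some 0) (some 1) (some o) ?_ ?_ ?_ ?_ ?_ ?_ hinf hzero hone ?_ <;>
      simp [crossRatio, (hO o ho).1.symm, (hO o ho).2.symm, ho]
  have hmul : ∀ {a b : F}, some a ∈ C → some b ∈ C → some (a * b) ∈ C := by
    intro a b ha hb
    by_cases h0 : a = 0
    · simpa [h0] using hzero
    have h : a * 1 - 0 * 0 ≠ 0 := by simpa using h0
    have hm := isPGL_moebiusPerm a 0 0 1 h
    have e : ∀ x, moebiusPerm a 0 0 1 h x = moebius (RingEquiv.refl F) a 0 0 1 x := fun _ => rfl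
    have := hm.mem_oclosure hcl hb (by simpa [e, moebius]) (by simpa [e, moebius])
      (by simpa [e, moebius])
    simpa [e, moebius] using this
  have hinv : ∀ {a : F}, some a ∈ C → some a⁻¹ ∈ C := by
    intro a ha
    by_cases h0 : a = 0
    · simpa [h0] using hzero
    have h : (0 : F) * 0 - 1 * 1 ≠ 0 := by simp
    have hm := isPGL_moebiusPerm 0 1 1 0 h
    have e : ∀ x, moebiusPerm 0 1 1 0 h x = moebius (RingEquiv.refl F) 0 1 1 0 x := fun _ => rfl
    have := hm.mem_oclosure hcl ha (by simpa [e, moebius]) (by simpa [e, moebius])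
      (by simpa [e, moebius])
    simpa [e, moebius, h0] using this
  have hsub : ∀ {a : F}, some a ∈ C → some (1 - a) ∈ C := by
    intro a ha
    have h : (-1 : F) * 1 - 1 * 0 ≠ 0 := by simp
    have hm := isPGL_moebiusPerm (-1) 1 0 1 h
    have e : ∀ x, moebiusPerm (-1) 1 0 1 h x = moebius (RingEquiv.refl F) (-1) 1 0 1 x :=
      fun _ => rfl
    have := hm.mem_oclosure hcl ha (by simpa [e, moebius]) (by simpa [e, moebius])
      (by simpa [e, moebius])
    simpa [e, moebius, neg_add_eq_sub] using this
  have hsub' : ∀ {a b : F}, a ≠ 0 → some a ∈ C → some b ∈ C → some (a - b) ∈ C := by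
    intro a b h0 ha hb
    have := hmul ha (hsub (hmul (hinv ha) hb))
    rwa [show a * (1 - a⁻¹ * b) = a - b by field_simp] at this
  have hneg_one : some (-1 : F) ∈ C := by
    obtain ⟨o, ho⟩ := hne
    have h1 := hsub' (hO o ho).1 (hOC o ho) hone
    have h2 := hmul (hinv (hsub (hOC o ho))) h1
    have : 1 - o ≠ 0 := fun h => (hO o ho).2 (sub_eq_zero.1 h).symm
    rwa [show (1 - o)⁻¹ * (o - 1) = -1 by field_simp; ring] at h2
  have hneg : ∀ {a : F}, some a ∈ C → some (-a) ∈ C := fun ha => by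
    simpa using hmul hneg_one ha
  induction h using Subfield.closure_induction with
  | mem x hx => exact hOC x hx
  | one => exact hone
  | add x y _ _ hx hy =>
    by_cases h0 : x = 0
    · simpa [h0] using hy
    · simpa using hsub' h0 hx (hneg hy)
  | neg x _ hx => exact hneg hx
  | inv x _ hx => exact hinv hx
  | mul x y _ _ hx hy => exact hmul hx hy

theorem mem_oclosure_iff {O : Set F} (hne : O.Nonempty) (hO : ∀ x ∈ O, x ≠ 0 ∧ x ≠ 1)
    {p q r d : Option F} (hpq : p ≠ q) (hpr : p ≠ r) (hpd : p ≠ d) (hqr : q ≠ r) (hqd : q ≠ d)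
    (hrd : r ≠ d) : d ∈ OClosure O p q r ↔ crossRatio p q r d ∈ Subfield.closure O := by
  obtain ⟨m, hm, rfl, rfl, rfl⟩ := exists_isPGL hpq hpr hqr
  obtain ⟨d, rfl⟩ := m.surjective d
  have hi : ∀ {x y}, m x ≠ m y → x ≠ y := fun h h' => h (h' ▸ rfl)
  rw [(hm.opreserving O).mem_oclosure_iff,
    hm.crossRatio (hi hpq) (hi hpr) (hi hpd) (hi hqr) (hi hqd) (hi hrd)]
  rcases d with _ | d
  · exact absurd rfl hpd
  · rw [some_mem_oclosure_iff hne hO]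
    simp [crossRatio]

theorem OPreserving.subfield_closure {O : Set F} (hne : O.Nonempty)
    (hO : ∀ x ∈ O, x ≠ 0 ∧ x ≠ 1) {f : Equiv.Perm (Option F)} (hf : OPreserving O f) :
    OPreserving (Subfield.closure O : Set F) f := by
  intro p q r d h1 h2 h3 h4 h5 h6
  have hi := f.injective
  rw [SetLike.mem_coe, SetLike.mem_coe, ← _root_.mem_oclosure_iff hne hO h1 h2 h3 h4 h5 h6,
    ← _root_.mem_oclosure_iff hne hO (hi.ne h1) (hi.ne h2) (hi.ne h3) (hi.ne h4) (hi.ne h5) (hi.ne h6),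
    hf.mem_oclosure_iff]

theorem OPreserving.exists_perm {K : Subfield F} {f : Equiv.Perm (Option F)}
    (hf : OPreserving (K : Set F) f) (hinf : f none = none) :
    ∃ g : Equiv.Perm F, (∀ x, f (some x) = some (g x)) ∧ PreservesCollinear K g := by
  have hg : ∀ x, f (some x) = some (Equiv.removeNone f x) := fun x =>
    (Equiv.removeNone_some f (by
      rcases h : f (some x) with _ | y
      · exact absurd (f.injective (h.trans hinf.symm)) (by simp)
      · exact ⟨y, rfl⟩)).symm
  refine ⟨Equiv.removeNone f, hg, fun x y z hxy => ?_⟩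
  by_cases hxz : z = x
  · simp [hxz, K.zero_mem]
  by_cases hyz : z = y
  · have h1 : y - x ≠ 0 := sub_ne_zero.2 hxy.symm
    have h2 : Equiv.removeNone f y - Equiv.removeNone f x ≠ 0 :=
      sub_ne_zero.2 fun h => hxy ((Equiv.removeNone f).injective h).symm
    simp [hyz, K.one_mem, h1, h2]
  have := hf none (some x) (some y) (some z) (by simp) (by simp) (by simp) (by simpa)
    (by simpa using Ne.symm hxz) (by simpa using Ne.symm hyz)
  simpa [hinf, hg, crossRatio] using this

theorem exists_ringEquiv_of_opreserving_subfield {K : Subfield F} (hK : K ≠ ⊤)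
    {s : F} (hs : s ∈ K) (hs0 : s ≠ 0) (hs1 : s ≠ 1)
    (hperf : ringChar F = 2 → ∀ y : F, ∃ z, z ^ 2 = y)
    {f : Equiv.Perm (Option F)} (hf : OPreserving (K : Set F) f) (hinf : f none = none)
    (hzero : f (some 0) = some 0) (hone : f (some 1) = some 1) :
    ∃ σ : F ≃+* F, ∀ x, f x = x.map σ := by
  have hdet : (0 : F) * 0 - 1 * 1 ≠ 0 := by simp
  let ι := moebiusPerm (0 : F) 1 1 0 hdet
  have hι : OPreserving (K : Set F) ι := (isPGL_moebiusPerm _ _ _ _ hdet).opreserving _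
  have e : ∀ x, ι x = moebius (RingEquiv.refl F) 0 1 1 0 x := fun _ => rfl
  have ι_none : ι none = some 0 := by simp [e, moebius]
  have ι_zero : ι (some 0) = none := by simp [e, moebius]
  have ι_some : ∀ x ≠ 0, ι (some x) = some x⁻¹ := fun x hx => by simp [e, moebius, hx]
  obtain ⟨g, hgf, hg⟩ := hf.exists_perm hinf
  obtain ⟨h, hhf, hh⟩ := (hι.mul (hf.mul hι)).exists_perm (by simp [ι_none, ι_zero, hzero])
  have g0 : g 0 = 0 := Option.some_injective _ (by rw [← hgf, hzero])
  have g1 : g 1 = 1 := Option.some_injective _ (by rw [← hgf, hone])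
  have h0 : h 0 = 0 := Option.some_injective _ (by rw [← hhf]; simp [ι_zero, hinf, ι_none])
  have gne : ∀ {x}, x ≠ 0 → g x ≠ 0 := PreservesCollinear.map_ne_zero g0
  have hhg : ∀ x, h x = (g x⁻¹)⁻¹ := by
    intro x
    by_cases hx : x = 0
    · simp [hx, h0, g0]
    · apply Option.some_injective
      rw [← hhf]
      simp [ι_some x hx, hgf, ι_some _ (gne (inv_ne_zero hx))]
  have hgh : ∀ x, g x⁻¹ = (h x)⁻¹ := fun x => by rw [hhg, inv_inv]
  have h1 : h 1 = 1 := by simp [hhg, g1]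
  have hz : ∀ x, h x = 0 ↔ x = 0 := fun x => by
    rw [← h.apply_eq_iff_eq (x := x) (y := 0), h0]
  have gadd := hg.map_add g0 hK hs hs0 hs1
  have hadd := hh.map_add h0 hK hs hs0 hs1
  have hsq := map_sq_of_map_inv gadd hadd hz h1 hgh
  have hmul : ∀ x y, h (x * y) = h x * h y := by
    by_cases h2 : (2 : F) = 0
    · have hchar : ringChar F = 2 := CharP.ringChar_of_prime_eq_zero Nat.prime_two (by simpa)
      have : CharP F 2 := ringChar.of_eq hchar
      have gK := fun l (hl : l ∈ K) => hg.map_mul g0 g1 hK hs hs0 hs1 hl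
      have hhK := fun l (hl : l ∈ K) => hh.map_mul h0 h1 hK hs hs0 hs1 hl
      exact map_mul_of_map_cube (hperf hchar) hadd hz h1 hsq
        (map_cube_of_map_inv gadd hadd hz h1 hgh gK hhK hs hs0 hs1) hhK hs hs0 hs1
    · exact map_mul_of_map_sq h2 hadd hsq
  refine ⟨{ h with map_mul' := hmul, map_add' := hadd }, ?_⟩
  have hinv : ∀ x, g x = h x := by
    intro x
    by_cases hx : x = 0
    · rw [hx, g0, h0]
    · have := hgh x⁻¹
      rw [inv_inv] at this
      rw [this]
      exact inv_eq_of_mul_eq_one_right (by rw [← hmul, inv_mul_cancel₀ hx, h1])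
  rintro (_ | x)
  · exact hinf
  · rw [hgf, hinv]; rfl

end Projective

/-- Corollary 2.11 (main corollary): if `O` is a nonempty `Aut(F)`-invariant subset of
`F \ {0,1}` generating a proper subfield `k(O) ⊊ F` (and, in characteristic 2, `F` is
perfect with `|F| > 4`), then the group of `O`-preserving permutations of `F ∪ {∞}` is
exactly `PΓL₂(F)`. -/
theorem O_preserving_perms_eq_PGammaL2 {F : Type*} [Field F]
    (O : Set F) (hne : O.Nonempty) (hO : ∀ x ∈ O, x ≠ 0 ∧ x ≠ 1)
    (hInv : ∀ σ : F ≃+* F, ∀ x ∈ O, σ x ∈ O)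
    (hKO : Subfield.closure O ≠ ⊤)
    (hchar2 : ringChar F = 2 →
      (∀ y : F, ∃ z : F, z ^ 2 = y) ∧ 4 < Cardinal.mk F) :
    {f : Equiv.Perm (Option F) | OPreserving O f} = PGammaL2 F := by
  ext f
  refine ⟨fun hf => ?_, opreserving_of_mem_PGammaL2 hInv⟩
  have hi := f.injective
  obtain ⟨m, hm, m1, m2, m3⟩ := exists_isPGL (hi.ne (show none ≠ some (0 : F) by simp))
    (hi.ne (show none ≠ some (1 : F) by simp)) (hi.ne (show some (0 : F) ≠ some 1 by simp))
  obtain ⟨s, hs⟩ := hne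
  obtain ⟨σ, hσ⟩ := exists_ringEquiv_of_opreserving_subfield hKO (Subfield.subset_closure hs)
    (hO s hs).1 (hO s hs).2 (fun h => (hchar2 h).1)
    (((hm.opreserving O).inv.mul hf).subfield_closure ⟨s, hs⟩ hO)
    (by simp [← m1]) (by simp [← m2]) (by simp [← m3])
  obtain ⟨a, b, c, d, h, hm⟩ := hm
  refine ⟨σ, a, b, c, d, h, fun x => ?_⟩
  have : f x = m ((m⁻¹ * f) x) := by simp
  rw [this, hσ, hm]
  rcases x with _ | x <;> rfl
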